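/- Let T be a bounded self-adjoint operator on a complex Hilbert space H with spectrum σ(T), θ ∈ ℝ, and à on H × H given by Ã(h₁,h₂) = (e^{−iθ}·T h₂, −e^{iθ}·T h₁). If λ is a real number with λ ∉ σ(T) and −λ ∉ σ(T), then iλ ∉ σ(Ã). -/

import Mathlib

open Complex in
theorem resolvent_of_tilde_A {H : Type*} [NormedAddCommGroup H]
    [InnerProductSpace ℂ H] [CompleteSpace H] (T : H →L[ℂ] H)
    (hT : IsSelfAdjoint T) (θ : ℝ)
    (A : WithLp 2 (H × H) →L[ℂ] WithLp 2 (H × H))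
    (hA : ∀ h₁ h₂ : H,
      A ((WithLp.equiv 2 (H × H)).symm (h₁, h₂)) =
        (WithLp.equiv 2 (H × H)).symm (exp (-θ * I) • T h₂, -(exp (θ * I) • T h₁)))
    (lam : ℝ) (h1 : (lam : ℂ) ∉ spectrum ℂ T) (h2 : (-lam : ℂ) ∉ spectrum ℂ T) :
    I * lam ∉ spectrum ℂ A := by
  rw [spectrum.notMem_iff] at h1 h2 ⊢
  have hU := h1.mul h2
  have hb := ContinuousLinearMap.isUnit_iff_bijective.mp hU
  have hS : ∀ w, (((algebraMap ℂ (H →L[ℂ] H)) lam - T) *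
      ((algebraMap ℂ (H →L[ℂ] H)) (-lam) - T)) w = T (T w) - ((lam : ℂ) * lam) • w := by
    intro w
    simp only [Algebra.algebraMap_eq_smul_one, ContinuousLinearMap.mul_apply,
      ContinuousLinearMap.sub_apply, ContinuousLinearMap.smul_apply,
      ContinuousLinearMap.one_apply, map_sub, map_smul]
    module
  have he : exp (-θ * I) * exp (θ * I) = 1 := by
    rw [← Complex.exp_add]; simp
  have he' : exp (θ * I) * exp (-θ * I) = 1 := by rw [mul_comm]; exact he
  have hA2 : ∀ x, A (A x) = (WithLp.equiv 2 (H × H)).symm (-(T (T x.fst)), -(T (T x.snd))) := by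
    intro x
    have hx : x = (WithLp.equiv 2 (H × H)).symm (x.fst, x.snd) := rfl
    conv_lhs => rw [hx, hA, hA]
    simp only [map_neg, map_smul, smul_neg, smul_smul, he, he', one_smul]
  have hI : I * (lam : ℂ) * (I * lam) = -((lam : ℂ) * lam) := by
    linear_combination (lam : ℂ) * lam * I_mul_I
  have happ : ∀ x, ((algebraMap ℂ (WithLp 2 (H × H) →L[ℂ] WithLp 2 (H × H))) (I * lam) - A) x
      = (I * (lam : ℂ)) • x - A x := by
    intro x
    simp [Algebra.algebraMap_eq_smul_one]
  rw [ContinuousLinearMap.isUnit_iff_bijective]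
  constructor
  · rw [injective_iff_map_eq_zero]
    intro x hx
    rw [happ, sub_eq_zero] at hx
    have h3 : A (A x) = (-((lam : ℂ) * lam)) • x := by
      rw [← hx, map_smul, ← hx, smul_smul, hI]
    rw [hA2] at h3
    have z : ∀ w, -(T (T w)) = (-((lam : ℂ) * lam)) • w → w = 0 := by
      intro w hw
      apply (injective_iff_map_eq_zero _).mp hb.1
      rw [hS, ← neg_eq_zero, neg_sub, sub_eq_add_neg, hw]
      module
    have e1 := z x.fst (congrArg (fun v => v.fst) h3)
    have e2 := z x.snd (congrArg (fun v => v.snd) h3)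
    have hx' : x = (WithLp.equiv 2 (H × H)).symm (x.fst, x.snd) := rfl
    rw [hx', e1, e2]; rfl
  · intro y
    obtain ⟨u, hu⟩ := hb.2 y.fst
    obtain ⟨v, hv⟩ := hb.2 y.snd
    rw [hS] at hu hv
    refine ⟨(I * (lam : ℂ)) • (WithLp.equiv 2 (H × H)).symm (u, v)
      + A ((WithLp.equiv 2 (H × H)).symm (u, v)), ?_⟩
    rw [happ, map_add, map_smul, hA2, smul_add, smul_smul, hI]
    have hy : y = (WithLp.equiv 2 (H × H)).symm (y.fst, y.snd) := rfl
    rw [hy, ← hu, ← hv]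
    have : (WithLp.equiv 2 (H × H)).symm (T (T u) - ((lam : ℂ) * lam) • u,
        T (T v) - ((lam : ℂ) * lam) • v) = (-((lam : ℂ) * lam)) •
        (WithLp.equiv 2 (H × H)).symm (u, v)
        - (WithLp.equiv 2 (H × H)).symm (-(T (T u)), -(T (T v))) := by
      apply (WithLp.equiv 2 (H × H)).injective
      apply Prod.ext
      · change T (T u) - ((lam : ℂ) * lam) • u = (-((lam : ℂ) * lam)) • u - -(T (T u))
        module
      · change T (T v) - ((lam : ℂ) * lam) • v = (-((lam : ℂ) * lam)) • v - -(T (T v))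
        module
    rw [this]
    change _ - (_ + (WithLp.equiv 2 (H × H)).symm (-(T (T u)), -(T (T v)))) = _
    abel
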